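/- Let p, n ≥ 1 and let B, D ∈ ℂ^{p×p} satisfy tr(D^k) ≠ 0 for all k ∈ {1, …, n}. For L₁, L₂ ∈ ℂ^{n×n} set J₁ = Iₙ ⊗ B − L₁ ⊗ D and J₂ = Iₙ ⊗ B − L₂ ⊗ D. Then J₁ and J₂ have equal characteristic polynomials (equivalently, the same eigenvalues counted with algebraic multiplicity) if and only if L₁ and L₂ have equal characteristic polynomials. -/

import Mathlib

open Matrix
open scoped Kronecker

/-- determinant of a polynomial in a matrix -/
theorem aux_det_aeval {ι : Type*} [Fintype ι] [DecidableEq ι] (A : Matrix ι ι ℂ)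
    (q : Polynomial ℂ) :
    (Polynomial.aeval A q).det = (A.charpoly.roots.map (fun l => q.eval l)).prod := by
  have hcard : A.charpoly.roots.card = Fintype.card ι := by
    rw [IsAlgClosed.card_roots_eq_natDegree, charpoly_natDegree_eq_dim]
  have hch : ∀ m : ℂ, (A - algebraMap ℂ _ m).det
      = (A.charpoly.roots.map (fun l => l - m)).prod := by
    intro m
    have h1 : (A.charpoly).eval m = (A.charpoly.roots.map (fun l => m - l)).prod := by
      conv_lhs => rw [(IsAlgClosed.splits A.charpoly).eq_prod_roots_of_monic A.charpoly_monic]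
      rw [Polynomial.eval_multiset_prod, Multiset.map_map]
      simp
    rw [Matrix.eval_charpoly] at h1
    have h2 : A - algebraMap ℂ _ m = -(Matrix.scalar ι m - A) := by
      rw [neg_sub]; rfl
    rw [h2, Matrix.det_neg, h1, ← hcard, ← Multiset.card_map (fun l => m - l),
      ← Multiset.prod_map_neg, Multiset.map_map]
    simp
  have key : ∀ s : Multiset ℂ,
      (Polynomial.aeval A (s.map (fun a => Polynomial.X - Polynomial.C a)).prod).det =
      (A.charpoly.roots.map (fun l =>
        ((s.map (fun a => Polynomial.X - Polynomial.C a)).prod).eval l)).prod := by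
    intro s
    induction s using Multiset.induction_on with
    | empty => simp
    | cons a s ih =>
      simp only [Multiset.map_cons, Multiset.prod_cons, map_mul, Matrix.det_mul, ih,
        Polynomial.eval_mul, Multiset.prod_map_mul]
      congr 1
      simp only [map_sub, Polynomial.aeval_X, Polynomial.aeval_C, hch, Polynomial.eval_sub,
        Polynomial.eval_X, Polynomial.eval_C]
  have hq := (IsAlgClosed.splits q).eq_prod_roots
  rw [hq, map_mul, Matrix.det_mul, key]
  simp only [Polynomial.eval_mul, Multiset.prod_map_mul, Polynomial.eval_C, Polynomial.aeval_C,
    Multiset.map_const', Multiset.prod_replicate, hcard]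
  congr 1
  rw [Matrix.algebraMap_eq_diagonal]
  simp

theorem aux_trace_pow {ι : Type*} [Fintype ι] [DecidableEq ι] (A : Matrix ι ι ℂ) (k : ℕ) :
    (A ^ k).trace = (A.charpoly.roots.map (fun l => l ^ k)).sum := by
  have h : (A ^ k).charpoly
      = ((A.charpoly.roots.map (fun l => l ^ k)).map
          (fun a => Polynomial.X - Polynomial.C a)).prod := by
    apply Polynomial.funext
    intro y
    rw [Matrix.eval_charpoly]
    have := aux_det_aeval A (Polynomial.C y - Polynomial.X ^ k)
    simp only [map_sub, Polynomial.aeval_C, map_pow, Polynomial.aeval_X, Polynomial.eval_sub,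
      Polynomial.eval_C, Polynomial.eval_pow, Polynomial.eval_X] at this
    rw [Polynomial.eval_multiset_prod, Multiset.map_map, Multiset.map_map]
    simp only [Function.comp_def, Polynomial.eval_sub, Polynomial.eval_X, Polynomial.eval_C]
    exact this
  rw [Matrix.trace_eq_sum_roots_charpoly, h, Polynomial.roots_multiset_prod_X_sub_C]

theorem aux_newton (n : ℕ) (f g : Fin n → ℂ)
    (h : ∀ k, 1 ≤ k → k ≤ n → ∑ i, f i ^ k = ∑ i, g i ^ k) :
    ∀ k, k ≤ n → MvPolynomial.aeval f (MvPolynomial.esymm (Fin n) ℂ k)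
      = MvPolynomial.aeval g (MvPolynomial.esymm (Fin n) ℂ k) := by
  intro k
  induction k using Nat.strong_induction_on with
  | _ k ih =>
    intro hk
    rcases Nat.eq_zero_or_pos k with rfl | hpos
    · simp
    have h1 := congrArg (MvPolynomial.aeval f) (MvPolynomial.mul_esymm_eq_sum (Fin n) ℂ k)
    have h2 := congrArg (MvPolynomial.aeval g) (MvPolynomial.mul_esymm_eq_sum (Fin n) ℂ k)
    have hk0 : (k : ℂ) ≠ 0 := by exact_mod_cast hpos.ne'
    apply mul_left_cancel₀ hk0
    simp only [map_mul, map_natCast, map_sum, map_pow, map_neg, map_one] at h1 h2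
    rw [h1, h2]
    congr 1
    apply Finset.sum_congr rfl
    rintro ⟨a, b⟩ hab
    rw [Finset.mem_filter] at hab
    have hsum : a + b = k := Finset.HasAntidiagonal.mem_antidiagonal.mp hab.1
    have hlt : a < k := hab.2
    rw [ih a hab.2 (by omega)]
    congr 1
    simp only [MvPolynomial.psum, map_sum, map_pow, MvPolynomial.aeval_X]
    exact h b (by omega) (by omega)

theorem aux_multiset_fun (n : ℕ) (s : Multiset ℂ) (hs : s.card = n) :
    ∃ f : Fin n → ℂ, Finset.univ.val.map f = s := by
  obtain ⟨l, rfl⟩ : ∃ l : List ℂ, (l : Multiset ℂ) = s := ⟨s.toList, s.coe_toList⟩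
  rw [Multiset.coe_card] at hs
  subst hs
  refine ⟨l.get, ?_⟩
  rw [Fin.univ_val_map, List.ofFn_get]

theorem aux_charpoly_eq {ι : Type*} [Fintype ι] [DecidableEq ι] (A B : Matrix ι ι ℂ)
    (h : ∀ k, 1 ≤ k → k ≤ Fintype.card ι → (A ^ k).trace = (B ^ k).trace) :
    A.charpoly = B.charpoly := by
  have hcard : ∀ A : Matrix ι ι ℂ, A.charpoly.roots.card = Fintype.card ι := fun A => by
    rw [IsAlgClosed.card_roots_eq_natDegree, charpoly_natDegree_eq_dim]
  obtain ⟨f, hf⟩ := aux_multiset_fun _ _ (hcard A)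
  obtain ⟨g, hg⟩ := aux_multiset_fun _ _ (hcard B)
  have hN := aux_newton _ f g (by
    intro k h1 h2
    have := h k h1 h2
    rw [aux_trace_pow, aux_trace_pow, ← hf, ← hg, Multiset.map_map, Multiset.map_map] at this
    exact this)
  rw [(IsAlgClosed.splits A.charpoly).eq_prod_roots_of_monic A.charpoly_monic,
    (IsAlgClosed.splits B.charpoly).eq_prod_roots_of_monic B.charpoly_monic,
    Multiset.prod_X_sub_X_eq_sum_esymm, Multiset.prod_X_sub_X_eq_sum_esymm, hcard, hcard]
  apply Finset.sum_congr rfl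
  intro j hj
  have := hN j (by simp at hj; omega)
  rw [MvPolynomial.aeval_esymm_eq_multiset_esymm, MvPolynomial.aeval_esymm_eq_multiset_esymm,
    hf, hg] at this
  rw [this]

/-- Sum over words in `B`, `-D` of length `k` with `m` letters `-D`. -/
def auxW {p : ℕ} (B D : Matrix (Fin p) (Fin p) ℂ) : ℕ → ℕ → Matrix (Fin p) (Fin p) ℂ
  | 0, 0 => 1
  | 0, _ + 1 => 0
  | k + 1, 0 => auxW B D k 0 * B
  | k + 1, m + 1 => auxW B D k (m + 1) * B - auxW B D k m * D

theorem auxW_zero {p : ℕ} (B D : Matrix (Fin p) (Fin p) ℂ) (k : ℕ) :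
    ∀ m, k < m → auxW B D k m = 0 := by
  induction k with
  | zero => rintro (_ | m) h; · omega
            · rfl
  | succ k ih =>
    rintro (_ | m) h
    · omega
    · rw [auxW, ih _ (by omega), ih _ (by omega)]; simp

theorem auxW_diag {p : ℕ} (B D : Matrix (Fin p) (Fin p) ℂ) (k : ℕ) :
    auxW B D k k = (-1 : ℂ) ^ k • D ^ k := by
  induction k with
  | zero => simp [auxW]
  | succ k ih =>
    rw [auxW, auxW_zero B D k (k + 1) (by omega), ih, pow_succ, pow_succ]
    simp

theorem auxW_pow {p n : ℕ} (B D : Matrix (Fin p) (Fin p) ℂ) (L : Matrix (Fin n) (Fin n) ℂ)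
    (k : ℕ) :
    ((1 : Matrix (Fin n) (Fin n) ℂ) ⊗ₖ B - L ⊗ₖ D) ^ k =
      ∑ m ∈ Finset.range (k + 1), (L ^ m) ⊗ₖ (auxW B D k m) := by
  induction k with
  | zero => simp [auxW]
  | succ k ih =>
    rw [pow_succ, ih, mul_sub, Finset.sum_mul, Finset.sum_mul]
    simp only [← Matrix.mul_kronecker_mul, mul_one, ← pow_succ]
    rw [Finset.sum_range_succ' _ (k + 1)]
    have e : ∀ X : Matrix (Fin n) (Fin n) ℂ, ∀ Y Z : Matrix (Fin p) (Fin p) ℂ,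
        X ⊗ₖ (Y - Z) = X ⊗ₖ Y - X ⊗ₖ Z := by
      intro X Y Z
      ext i j
      simp [mul_sub]
    simp only [auxW, e, Finset.sum_sub_distrib]
    have h1 := Finset.sum_range_succ' (fun m => (L ^ m) ⊗ₖ (auxW B D k m * B)) (k + 1)
    rw [Finset.sum_range_succ, auxW_zero B D k (k + 1) (by omega)] at h1
    simp only [zero_mul, Matrix.kronecker_zero, add_zero] at h1
    rw [h1]
    abel

theorem auxW_trace {p n : ℕ} (B D : Matrix (Fin p) (Fin p) ℂ) (L : Matrix (Fin n) (Fin n) ℂ)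
    (k : ℕ) :
    (((1 : Matrix (Fin n) (Fin n) ℂ) ⊗ₖ B - L ⊗ₖ D) ^ k).trace =
      ∑ m ∈ Finset.range (k + 1), (L ^ m).trace * (auxW B D k m).trace := by
  rw [auxW_pow, Matrix.trace_sum]
  simp only [Matrix.trace_kronecker]

/-- If `tr(D^k) ≠ 0` for `k = 1, …, n`, then `J₁ = Iₙ ⊗ B − L₁ ⊗ D` and
`J₂ = Iₙ ⊗ B − L₂ ⊗ D` have equal characteristic polynomials if and only if
`L₁` and `L₂` have equal characteristic polynomials. -/
theorem charpoly_kronecker_injective (p n : ℕ) (hp : 1 ≤ p) (hn : 1 ≤ n)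
    (B D : Matrix (Fin p) (Fin p) ℂ)
    (hD : ∀ k : ℕ, 1 ≤ k → k ≤ n → (D ^ k).trace ≠ 0)
    (L₁ L₂ : Matrix (Fin n) (Fin n) ℂ) :
    ((1 : Matrix (Fin n) (Fin n) ℂ) ⊗ₖ B - L₁ ⊗ₖ D).charpoly =
        ((1 : Matrix (Fin n) (Fin n) ℂ) ⊗ₖ B - L₂ ⊗ₖ D).charpoly ↔
      L₁.charpoly = L₂.charpoly := by
  constructor
  · intro h
    apply aux_charpoly_eq
    rw [Fintype.card_fin]
    intro k
    induction k using Nat.strong_induction_on with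
    | _ k ih =>
      intro h1 h2
      have ht : (((1 : Matrix (Fin n) (Fin n) ℂ) ⊗ₖ B - L₁ ⊗ₖ D) ^ k).trace =
          (((1 : Matrix (Fin n) (Fin n) ℂ) ⊗ₖ B - L₂ ⊗ₖ D) ^ k).trace := by
        rw [aux_trace_pow, aux_trace_pow, h]
      rw [auxW_trace, auxW_trace, Finset.sum_range_succ, Finset.sum_range_succ] at ht
      have hs : ∑ m ∈ Finset.range k, (L₁ ^ m).trace * (auxW B D k m).trace =
          ∑ m ∈ Finset.range k, (L₂ ^ m).trace * (auxW B D k m).trace := by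
        apply Finset.sum_congr rfl
        intro m hm
        rw [Finset.mem_range] at hm
        rcases Nat.eq_zero_or_pos m with rfl | hpos
        · simp
        · rw [ih m hm hpos (by omega)]
      rw [hs] at ht
      refine mul_right_cancel₀ ?_ (add_left_cancel ht)
      rw [auxW_diag, Matrix.trace_smul, smul_eq_mul]
      exact mul_ne_zero (pow_ne_zero _ (by norm_num)) (hD k h1 h2)
  · intro h
    apply aux_charpoly_eq
    intro k _ _
    rw [auxW_trace, auxW_trace]
    simp only [aux_trace_pow, h]
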